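/- The number of permutations of length n that avoid the pattern 231 equals the n-th Catalan number C(n) = binomial(2n, n) / (n + 1). -/

import Mathlib

namespace TwoStacks

/-- A state of the two-stacks-in-series machine: remaining input,
stack 1, stack 2 (tops at the head), and the output so far. -/
structure St where
  inp : List ℕ
  s1 : List ℕ
  s2 : List ℕ
  out : List ℕ
deriving DecidableEq

/-- The three moves. -/
inductive Mv
  | rho  -- input → stack 1
  | lam  -- stack 1 → stack 2
  | mu   -- stack 2 → output
deriving DecidableEq

/-- One move of the machine (`none` if the move is not applicable). -/
def step : Mv → St → Option St
  | .rho, ⟨x :: xs, s1, s2, o⟩ => some ⟨xs, x :: s1, s2, o⟩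
  | .lam, ⟨i, x :: xs, s2, o⟩ => some ⟨i, xs, x :: s2, o⟩
  | .mu,  ⟨i, s1, x :: xs, o⟩ => some ⟨i, s1, xs, o ++ [x]⟩
  | _, _ => none

/-- Run a word of moves on a state. -/
def run (w : List Mv) (s : St) : Option St :=
  w.foldlM (fun s m => step m s) s

/-- The list 1,2,…,n. -/
def idSeq (n : ℕ) : List ℕ := (List.range n).map (· + 1)

/-- The one-line notation p(1),…,p(n) (values in {1,…,n}) of a permutation. -/
def permList {n : ℕ} (p : Equiv.Perm (Fin n)) : List ℕ :=
  List.ofFn fun i => (p i : ℕ) + 1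

/-- p is achievable: from input 1,…,n some word of moves outputs p(1),…,p(n). -/
def Achievable {n : ℕ} (p : Equiv.Perm (Fin n)) : Prop :=
  ∃ w, run w ⟨idSeq n, [], [], []⟩ = some ⟨[], [], [], permList p⟩

/-- p is sortable: from input p(1),…,p(n) some word of moves outputs 1,…,n. -/
def Sortable {n : ℕ} (p : Equiv.Perm (Fin n)) : Prop :=
  ∃ w, run w ⟨permList p, [], [], []⟩ = some ⟨[], [], [], idSeq n⟩

/-- A list of (distinct) naturals is achievable as an output. -/
def AchList (l : List ℕ) : Prop :=
  ∃ w, run w ⟨idSeq l.length, [], [], []⟩ = some ⟨[], [], [], l⟩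

/-- Standardization (pattern) of a list with distinct entries:
each entry is replaced by its rank (1-based). -/
def std (l : List ℕ) : List ℕ :=
  l.map fun x => (l.filter (· ≤ x)).length

/-- An operation sequence of length 3n: n of each letter, and every
prefix has #ρ ≥ #λ ≥ #μ. -/
def OpSeq (n : ℕ) (w : List Mv) : Prop :=
  w.length = 3 * n ∧ w.count .rho = n ∧ w.count .lam = n ∧ w.count .mu = n ∧
  ∀ u, u <+: w → u.count .mu ≤ u.count .lam ∧ u.count .lam ≤ u.count .rho

/-- An x,y-Catalan word: word over {x,y} with equally many x's and y's
in which every prefix has at least as many x's as y's. -/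
def CatWord (x y : Mv) (w : List Mv) : Prop :=
  (∀ m ∈ w, m = x ∨ m = y) ∧ w.count x = w.count y ∧
  ∀ u, u <+: w → u.count y ≤ u.count x

/-- Two words have the same effect: applied to any state on which both
are applicable, they give the same resulting state. -/
def SameEffect (v v' : List Mv) : Prop :=
  ∀ s t t', run v s = some t → run v' s = some t' → t = t'

/-- Rank of a letter for the order ρ < λ < μ. -/
def rk : Mv → ℕ
  | .rho => 0
  | .lam => 1
  | .mu => 2

/-- The order ρ < λ < μ on letters. -/
def mlt (a b : Mv) : Prop := rk a < rk b

/-- Lexicographic order on words induced by ρ < λ < μ. -/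
def wordLt (v v' : List Mv) : Prop := List.Lex mlt v v'

/-- No entry is immediately followed by its successor. -/
def IncAvoid (l : List ℕ) : Prop :=
  ∀ j (h : j + 1 < l.length), l.get ⟨j + 1, h⟩ ≠ l.get ⟨j, by omega⟩ + 1

/-- Single-stack machine: state = (remaining input, stack, output). -/
structure St1 where
  inp : List ℕ
  stk : List ℕ
  out : List ℕ

inductive Mv1 | push | pop

def step1 : Mv1 → St1 → Option St1
  | .push, ⟨x :: xs, st, o⟩ => some ⟨xs, x :: st, o⟩
  | .pop,  ⟨i, x :: xs, o⟩ => some ⟨i, xs, o ++ [x]⟩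
  | _, _ => none

def run1 (w : List Mv1) (s : St1) : Option St1 :=
  w.foldlM (fun s m => step1 m s) s

/-- p is sortable by a single stack. -/
def StackSortable {n : ℕ} (p : Equiv.Perm (Fin n)) : Prop :=
  ∃ w, run1 w ⟨permList p, [], []⟩ = some ⟨[], [], idSeq n⟩

/-- p avoids the pattern 231. -/
def Avoids231 {n : ℕ} (p : Equiv.Perm (Fin n)) : Prop :=
  ¬ ∃ i j k : Fin n, i < j ∧ j < k ∧ p k < p i ∧ p i < p j

/-- The 231-avoiding list attached to a binary tree: its node `v` carries the largest entry,
the left subtree the smallest entries and the right subtree those in between. The entries are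
`a, …, a + t.numNodes - 1`. -/
def treeList : ℕ → BinaryTree Unit → List ℕ
  | _, .nil => []
  | a, .node _ l r =>
    treeList a l ++ (a + (l.numNodes + r.numNodes)) :: treeList (a + l.numNodes) r

/-- A list avoids the pattern 231. -/
def ListAvoids231 (l : List ℕ) : Prop :=
  ∀ i j k (hij : i < j) (hjk : j < k) (hk : k < l.length), ¬ (l[k] < l[i] ∧ l[i] < l[j])

theorem treeList_perm (a : ℕ) (t : BinaryTree Unit) :
    (treeList a t).Perm (List.range' a t.numNodes) := by
  induction t generalizing a with
  | nil => simp [treeList]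
  | node _ l r ihl ihr =>
    have h : List.range' a (l.numNodes + r.numNodes + 1) =
        List.range' a l.numNodes ++ List.range' (a + l.numNodes) r.numNodes ++
          [a + (l.numNodes + r.numNodes)] := by
      rw [List.range'_append_1, List.range'_1_concat]
    simp only [treeList, BinaryTree.numNodes, h]
    refine List.perm_middle.trans ((List.Perm.cons _ ((ihl a).append (ihr _))).trans ?_)
    exact (List.perm_append_singleton _ _).symm

theorem length_treeList (a : ℕ) (t : BinaryTree Unit) : (treeList a t).length = t.numNodes := by
  simpa using (treeList_perm a t).length_eq

theorem mem_treeList {a : ℕ} {t : BinaryTree Unit} {x : ℕ} :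
    x ∈ treeList a t ↔ a ≤ x ∧ x < a + t.numNodes := by
  rw [(treeList_perm a t).mem_iff, List.mem_range'_1]

theorem treeList_injective (a : ℕ) : Function.Injective (treeList a) := by
  intro t
  induction t generalizing a with
  | nil =>
    intro u h
    cases u with
    | nil => rfl
    | node _ l r => simp [treeList] at h
  | node _ l r ihl ihr =>
    intro u h
    cases u with
    | nil => simp [treeList] at h
    | node _ l' r' =>
      have hlen := congrArg List.length h
      rw [length_treeList, length_treeList] at hlen
      simp only [BinaryTree.numNodes, add_left_inj] at hlen
      simp only [treeList] at h
      rw [hlen] at h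
      obtain ⟨h₁, -, h₂⟩ := List.append_cons_inj_of_notMem
        (by rw [mem_treeList]; omega) (by rw [mem_treeList]; omega) |>.1 h
      obtain rfl := ihl a h₁
      obtain rfl := ihr _ h₂
      rfl

theorem ListAvoids231.append_cons {l r : List ℕ} {m : ℕ} (hl : ListAvoids231 l)
    (hr : ListAvoids231 r) (hlr : ∀ x ∈ l, ∀ y ∈ r, x < y) (hlm : ∀ x ∈ l, x < m)
    (hrm : ∀ y ∈ r, y < m) : ListAvoids231 (l ++ m :: r) := by
  intro i j k hij hjk hk ⟨h₁, h₂⟩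
  have hk' : k < l.length + (r.length + 1) := by simpa using hk
  rcases lt_or_ge k l.length with hkl | hkl
  · exact hl i j k hij hjk hkl (by grind)
  rcases lt_or_ge i l.length with hil | hil
  · have := hlr l[i] (by simp)
    have := hlm l[i] (by simp)
    rcases hkl.eq_or_lt with hkl | hkl
    · grind
    · have := hlr l[i] (by simp) r[k - l.length - 1] (by simp)
      grind
  · rcases hil.eq_or_lt with hil | hil
    · have := hrm r[j - l.length - 1] (by simp)
      grind
    · exact hr (i - l.length - 1) (j - l.length - 1) (k - l.length - 1) (by omega) (by omega)
        (by omega) (by grind)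

theorem ListAvoids231.left {l r : List ℕ} (h : ListAvoids231 (l ++ r)) : ListAvoids231 l := by
  intro i j k hij hjk hk
  have := h i j k hij hjk (by simp; omega)
  grind

theorem ListAvoids231.right {l r : List ℕ} (h : ListAvoids231 (l ++ r)) : ListAvoids231 r := by
  intro i j k hij hjk hk
  have := h (l.length + i) (l.length + j) (l.length + k) (by omega) (by omega) (by simp; omega)
  grind

theorem ListAvoids231.le_of_mem {l r : List ℕ} {m : ℕ} (h : ListAvoids231 (l ++ m :: r))
    {x y : ℕ} (hx : x ∈ l) (hy : y ∈ r) (hxm : x < m) : x ≤ y := by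
  obtain ⟨i, hi, rfl⟩ := List.getElem_of_mem hx
  obtain ⟨k, hk, rfl⟩ := List.getElem_of_mem hy
  have := h i l.length (l.length + (k + 1)) hi (by omega) (by simp; omega)
  simp only [List.getElem_append_left hi, List.getElem_append_right, le_refl, Nat.sub_self,
    List.getElem_cons_zero, Nat.le_add_right, Nat.add_sub_cancel_left,
    List.getElem_cons_succ] at this
  omega

theorem listAvoids231_treeList (a : ℕ) (t : BinaryTree Unit) : ListAvoids231 (treeList a t) := by
  induction t generalizing a with
  | nil => intro i j k _ _ hk; simp [treeList] at hk
  | node _ l r ihl ihr =>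
    refine (ihl a).append_cons (ihr _) ?_ ?_ ?_ <;> simp only [mem_treeList] <;> intros <;> omega

/-- If a rearrangement of an interval splits into a lower and an upper part, then each part is a
rearrangement of an interval. -/
theorem perm_range'_of_append {l r : List ℕ} {a n : ℕ} (h : (l ++ r).Perm (List.range' a n))
    (hlr : ∀ x ∈ l, ∀ y ∈ r, x ≤ y) :
    l.Perm (List.range' a l.length) ∧ r.Perm (List.range' (a + l.length) r.length) := by
  have hn : l.length + r.length = n := by simpa using h.length_eq
  have hl := List.perm_insertionSort (· ≤ ·) l
  have hr := List.perm_insertionSort (· ≤ ·) r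
  have key : l.insertionSort (· ≤ ·) ++ r.insertionSort (· ≤ ·) =
      List.range' a l.length ++ List.range' (a + l.length) r.length := by
    rw [List.range'_append_1, hn]
    refine ((hl.append hr).trans h).eq_of_pairwise' (r := (· ≤ ·)) ?_ ?_
    · rw [List.pairwise_append]
      refine ⟨List.pairwise_insertionSort _ _, List.pairwise_insertionSort _ _, ?_⟩
      intro x hx y hy
      exact hlr x (hl.mem_iff.1 hx) y (hr.mem_iff.1 hy)
    · exact List.pairwise_le_range'
  obtain ⟨h₁, h₂⟩ := List.append_inj key (by simp)
  exact ⟨h₁ ▸ hl.symm, h₂ ▸ hr.symm⟩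

theorem exists_treeList_eq {a n : ℕ} {s : List ℕ} (hs : s.Perm (List.range' a n))
    (h : ListAvoids231 s) : ∃ t, treeList a t = s := by
  induction n using Nat.strong_induction_on generalizing a s with
  | _ n ih =>
    cases n with
    | zero => exact ⟨.nil, by simpa [treeList, eq_comm] using hs⟩
    | succ n =>
      rw [List.range'_1_concat] at hs
      obtain ⟨l, r, rfl⟩ := List.append_of_mem (hs.mem_iff.2 (by simp : a + n ∈ _))
      have hlr : (l ++ r).Perm (List.range' a n) :=
        ((List.perm_middle.symm.trans hs).trans (List.perm_append_singleton _ _)).cons_inv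
      have hlen : l.length + r.length = n := by simpa using hlr.length_eq
      have hlt : ∀ x ∈ l, x < a + n := fun x hx =>
        (List.mem_range'_1.1 (hlr.mem_iff.1 (List.mem_append_left r hx))).2
      obtain ⟨hl, hr⟩ := perm_range'_of_append hlr
        fun x hx y hy => h.le_of_mem hx hy (hlt x hx)
      obtain ⟨t, ht⟩ := ih _ (by omega) hl h.left
      obtain ⟨u, hu⟩ := ih _ (by omega) hr (ListAvoids231.right (l := l ++ [a + n]) (by simpa using h))
      have htl : t.numNodes = l.length := by rw [← length_treeList a t, ht]
      have hul : u.numNodes = r.length := by rw [← length_treeList _ u, hu]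
      exact ⟨.node () t u, by rw [treeList, htl, hul, ht, hu, hlen]⟩

theorem image_treeList (n : ℕ) :
    treeList 1 '' {t | t.numNodes = n} =
      {s | s.Perm (List.range' 1 n) ∧ ListAvoids231 s} := by
  ext s
  constructor
  · rintro ⟨t, rfl, rfl⟩
    exact ⟨treeList_perm 1 t, listAvoids231_treeList 1 t⟩
  · rintro ⟨hs, h⟩
    obtain ⟨t, rfl⟩ := exists_treeList_eq hs h
    exact ⟨t, by simpa [length_treeList] using hs.length_eq, rfl⟩

theorem permList_injective (n : ℕ) : Function.Injective (permList (n := n)) := by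
  intro p q h
  ext i
  simpa using congrFun (List.ofFn_injective h) i

theorem permList_perm {n : ℕ} (p : Equiv.Perm (Fin n)) :
    (permList p).Perm (List.range' 1 n) := by
  refine (List.perm_ext_iff_of_nodup ?_ List.nodup_range').2 fun x => ?_
  · refine List.nodup_ofFn.2 fun i j h => ?_
    simpa [Fin.val_inj] using h
  · simp only [permList, List.mem_ofFn, List.mem_range'_1]
    constructor
    · rintro ⟨i, rfl⟩
      omega
    · rintro ⟨h₁, h₂⟩
      exact ⟨p.symm ⟨x - 1, by omega⟩, by simp; omega⟩

theorem exists_permList_eq {n : ℕ} {s : List ℕ} (hs : s.Perm (List.range' 1 n)) :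
    ∃ p : Equiv.Perm (Fin n), permList p = s := by
  obtain rfl : s.length = n := by simpa using hs.length_eq
  have hmem (i : Fin s.length) : 1 ≤ s[i] ∧ s[i] < 1 + s.length :=
    List.mem_range'_1.1 (hs.mem_iff.1 (List.getElem_mem _))
  let f : Fin s.length → Fin s.length := fun i => ⟨s[i] - 1, by have := hmem i; omega⟩
  have hf : Function.Injective f := by
    intro i j hij
    have h := Fin.val_eq_of_eq hij
    have hi := hmem i
    have hj := hmem j
    simp only [f] at h
    exact (hs.nodup_iff.2 List.nodup_range').injective_get (by simp at *; omega)
  refine ⟨Equiv.ofBijective f hf.bijective_of_finite, List.ext_getElem (by simp [permList]) ?_⟩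
  intro i h₁ h₂
  have := hmem ⟨i, h₂⟩
  simp [permList, f] at *
  omega

theorem listAvoids231_permList {n : ℕ} {p : Equiv.Perm (Fin n)} :
    ListAvoids231 (permList p) ↔ Avoids231 p := by
  constructor
  · rintro h ⟨i, j, k, hij, hjk, h₁, h₂⟩
    exact h i j k hij hjk (by simp [permList]) (by simpa [permList] using ⟨h₁, h₂⟩)
  · intro h i j k hij hjk hk hlt
    have hk' : k < n := by simpa [permList] using hk
    exact h ⟨⟨i, by omega⟩, ⟨j, by omega⟩, ⟨k, hk'⟩, hij, hjk, by simpa [permList] using hlt⟩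

theorem image_permList (n : ℕ) :
    permList '' {p : Equiv.Perm (Fin n) | Avoids231 p} =
      {s | s.Perm (List.range' 1 n) ∧ ListAvoids231 s} := by
  ext s
  constructor
  · rintro ⟨p, hp, rfl⟩
    exact ⟨permList_perm p, listAvoids231_permList.2 hp⟩
  · rintro ⟨hs, h⟩
    obtain ⟨p, rfl⟩ := exists_permList_eq hs
    exact ⟨p, listAvoids231_permList.1 h, rfl⟩

theorem count_avoids_231_eq_catalan (n : ℕ) :
    Nat.card {p : Equiv.Perm (Fin n) // Avoids231 p} = (2 * n).choose n / (n + 1) := by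
  rw [← Nat.centralBinom_eq_two_mul_choose, ← catalan_eq_centralBinom_div,
    ← BinaryTree.treesOfNumNodesEq_card_eq_catalan, ← Set.ncard_coe_finset,
    BinaryTree.coe_treesOfNumNodesEq, ← Set.ncard_image_of_injective _ (treeList_injective 1),
    image_treeList, ← image_permList, Set.ncard_image_of_injective _ (permList_injective n)]
  rfl

end TwoStacks
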